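/- arXiv:1402.5391 — 2 statements merged into one kernel-verified Lean document; each statement's English description precedes it below -/
import Mathlib

section
/- Per-component coupling-time bounds for ATO-POS (Lemma 3.3): fix i ∈ {1,…,I}, set α_i = min_{1≤k≤C_i} μ_i(k) and η_i = max_{1≤k≤C_i−1} μ_i(k) (with η_i = 0 if C_i = 1), and let τ^{P,i} = min{t ≥ 0 : |φ_i(f_P(X, u_t u_{t−1}⋯u_1))| = 1}, where φ_i(x) = x_i and the word applies u_t first. Then: (a) if λ_i < α_i, the expectation (in [0,∞]) satisfies E[τ^{P,i}] ≤ Λ C_i/(α_i − λ_i); (b) if λ_i > η_i, E[τ^{P,i}] ≤ Λ C_i/(λ_i − η_i). -/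
open MeasureTheory Finset ENNReal

namespace ATO

/-- Events: joint arrivals `d A` for subsets `A`, and services `s i j`. -/
inductive Ev (I : ℕ) where
  | d : Finset (Fin I) → Ev I
  | s : Fin I → ℕ → Ev I

instance (I : ℕ) : MeasurableSpace (Ev I) := ⊤

/-- Valid events: arrivals for nonempty `A`, services `s i j` with `1 ≤ j ≤ C i`. -/
def ValidEv {I : ℕ} (C : Fin I → ℕ) : Ev I → Prop
  | .d A => A.Nonempty
  | .s i j => 1 ≤ j ∧ j ≤ C i

/-- The state space `X = {0,…,C 1} × ⋯ × {0,…,C I}`. -/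
def Xspace {I : ℕ} (C : Fin I → ℕ) : Set (Fin I → ℕ) := {x | ∀ i, x i ≤ C i}

/-- ATO-POS transition function with individual replenishments. -/
noncomputable def fP {I : ℕ} (C : Fin I → ℕ) (μ : Fin I → ℕ → ℝ) (ℓ : Fin I → ℕ → ℕ)
    (x : Fin I → ℕ) : Ev I → (Fin I → ℕ)
  | .d A => fun k => x k + if k ∈ A ∧ x k < C k then 1 else 0
  | .s i j => fun k => if k = i ∧ μ i (ℓ i j) ≤ μ i (x i) then x k - 1 else x k

/-- ATO-TOS transition function with individual replenishments. -/
noncomputable def fT {I : ℕ} (C : Fin I → ℕ) (μ : Fin I → ℕ → ℝ) (ℓ : Fin I → ℕ → ℕ)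
    (x : Fin I → ℕ) : Ev I → (Fin I → ℕ)
  | .d A => fun k => x k + if k ∈ A ∧ (∀ i ∈ A, x i < C i) then 1 else 0
  | .s i j => fP C μ ℓ x (.s i j)

/-- Iterated application of a transition function along a word (head applied first). -/
def iter {I : ℕ} {σ : Type*} (f : σ → Ev I → σ) : σ → List (Ev I) → σ
  | x, [] => x
  | x, a :: w => iter f (f x a) w

/-- The backward word `u_t u_{t-1} ⋯ u_1` (with `u_t` applied first). -/
def bword {I : ℕ} (ω : ℕ → Ev I) (t : ℕ) : List (Ev I) :=
  ((List.range t).reverse).map fun s => ω (s + 1)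

/-- The forward word `u_1 u_2 ⋯ u_t` (with `u_1` applied first). -/
def fword {I : ℕ} (ω : ℕ → Ev I) (t : ℕ) : List (Ev I) :=
  (List.range t).map fun s => ω (s + 1)

/-- The distribution `ν` on events: `ν (d A) = λ_A / Λ`, `ν (s i j) = (μ_i(ℓ_i^{(j)}) − μ_i(ℓ_i^{(j-1)}))/Λ`. -/
noncomputable def probA {I : ℕ} (C : Fin I → ℕ) (μ : Fin I → ℕ → ℝ) (ℓ : Fin I → ℕ → ℕ)
    (lam : Finset (Fin I) → ℝ) (Λ : ℝ) : Ev I → ℝ≥0∞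
  | .d A => if A.Nonempty then ENNReal.ofReal (lam A / Λ) else 0
  | .s i j => if 1 ≤ j ∧ j ≤ C i then ENNReal.ofReal ((μ i (ℓ i j) - μ i (ℓ i (j - 1))) / Λ) else 0

/-- The trajectory started at `x` and driven by a word never visits `Z`. -/
def Avoids {E σ : Type*} (g : σ → E → σ) (Z : Set σ) : List E → σ → Prop
  | [], x => x ∉ Z
  | a :: w, x => x ∉ Z ∧ Avoids g Z w (g x a)

open Classical in
/-- The probability that a trajectory driven by `t` independent letters of law `p` never visits
`Z`. -/
noncomputable def avoidProb {E σ : Type*} (p : E → ℝ≥0∞) (g : σ → E → σ) (Z : Set σ) :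
    ℕ → σ → ℝ≥0∞
  | 0, x => if x ∈ Z then 0 else 1
  | t + 1, x => if x ∈ Z then 0 else ∑' a, p a * avoidProb p g Z t (g x a)

/-- Foster's criterion: if `V` decreases by at least one in mean outside of `Z`, then the expected
hitting time of `Z` is at most `V`. -/
theorem sum_avoidProb_le {E σ : Type*} {p : E → ℝ≥0∞} {g : σ → E → σ} {Z S : Set σ}
    {V : σ → ℝ≥0∞} (hS : ∀ x ∈ S, ∀ a, g x a ∈ S)
    (hV : ∀ x ∈ S, x ∉ Z → 1 + ∑' a, p a * V (g x a) ≤ V x) (t : ℕ) :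
    ∀ x ∈ S, ∑ s ∈ Finset.range t, avoidProb p g Z s x ≤ V x := by
  induction t with
  | zero => simp
  | succ t ih =>
    intro x hx
    by_cases hZ : x ∈ Z
    · have h0 : ∀ s, avoidProb p g Z s x = 0 := by
        intro s
        cases s <;> simp [avoidProb, hZ]
      simp [h0]
    · rw [Finset.sum_range_succ']
      refine le_trans ?_ (hV x hx hZ)
      simp only [avoidProb, hZ, if_false]
      rw [add_comm, ← Summable.tsum_finsetSum (fun _ _ => ENNReal.summable)]
      gcongr with a
      rw [← Finset.mul_sum]
      gcongr
      exact ih _ (hS x hx a)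

/-- Trajectories related by an invariant relation `r` coalesce once the second one visits `Z`. -/
theorem iter_eq_of_not_avoids {I : ℕ} {σ : Type*} {g : σ → Ev I → σ} {Z : Set σ}
    {r : σ → σ → Prop} (hr : ∀ x y a, r x y → r (g x a) (g y a))
    (hZ : ∀ x y, r x y → y ∈ Z → x = y) :
    ∀ (w : List (Ev I)) (x y : σ), r x y → ¬ Avoids g Z w y → iter g x w = iter g y w
  | [], x, y, hxy, h => hZ x y hxy (not_not.1 h)
  | a :: w, x, y, hxy, h => by
    by_cases hy : y ∈ Z
    · rw [hZ x y hxy hy]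
    · exact iter_eq_of_not_avoids hr hZ w _ _ (hr x y a hxy) fun h' => h ⟨hy, h'⟩

theorem bword_succ {I : ℕ} (ω : ℕ → Ev I) (t : ℕ) :
    bword ω (t + 1) = ω (t + 1) :: bword ω t := by
  simp [bword, List.range_succ]

/-- Events as a disjoint union of arrivals and services. -/
def evEquiv (I : ℕ) : Ev I ≃ Finset (Fin I) ⊕ (Fin I × ℕ) where
  toFun
    | .d A => .inl A
    | .s i j => .inr (i, j)
  invFun
    | .inl A => .d A
    | .inr x => .s x.1 x.2
  left_inv a := by cases a <;> rfl
  right_inv a := by rcases a with A | ⟨i, j⟩ <;> rfl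

instance (I : ℕ) : Countable (Ev I) := (evEquiv I).countable_iff.2 inferInstance

instance (I : ℕ) : MeasurableSingletonClass (Ev I) := ⟨fun _ => trivial⟩

theorem tsum_ev {I : ℕ} (F : Ev I → ℝ≥0∞) :
    ∑' a, F a = ∑ A, F (.d A) + ∑ k, ∑' j, F (.s k j) := by
  rw [← (evEquiv I).symm.tsum_eq, ENNReal.summable.tsum_sum ENNReal.summable, tsum_fintype,
    ENNReal.tsum_prod', tsum_fintype]
  rfl

theorem measurableSet_avoids {I : ℕ} {σ : Type*} (g : σ → Ev I → σ) (Z : Set σ) (s : ℕ) :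
    ∀ x, MeasurableSet {ω : ℕ → Ev I | Avoids g Z (bword ω s) x} := by
  induction s with
  | zero => intro x; exact MeasurableSet.const (x ∉ Z)
  | succ s ih =>
    intro x
    have h : {ω : ℕ → Ev I | Avoids g Z (bword ω (s + 1)) x} =
        {_ω | x ∉ Z} ∩ ⋃ a, (fun ω : ℕ → Ev I => ω (s + 1)) ⁻¹' {a} ∩
          {ω | Avoids g Z (bword ω s) (g x a)} := by
      ext ω
      simp [bword_succ, Avoids]
    rw [h]
    exact (MeasurableSet.const _).inter (MeasurableSet.iUnion fun a =>
      (measurable_pi_apply (X := fun _ => Ev I) (s + 1) (measurableSet_singleton a)).inter (ih _))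

theorem measure_cylinder_inter_avoids {I : ℕ} {σ : Type*} {p : Ev I → ℝ≥0∞}
    (P : Measure (ℕ → Ev I))
    (hiid : ∀ (T : Finset ℕ) (u : ℕ → Ev I), P {ω | ∀ t ∈ T, ω t = u t} = ∏ t ∈ T, p (u t))
    (g : σ → Ev I → σ) (Z : Set σ) (s : ℕ) :
    ∀ (T : Finset ℕ) (u : ℕ → Ev I) (x : σ), (∀ t ∈ T, s < t) →
      P ({ω | ∀ t ∈ T, ω t = u t} ∩ {ω | Avoids g Z (bword ω s) x}) =
        (∏ t ∈ T, p (u t)) * avoidProb p g Z s x := by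
  induction s with
  | zero =>
    intro T u x _
    by_cases hZ : x ∈ Z
    · simp [bword, Avoids, avoidProb, hZ]
    · simp [bword, Avoids, avoidProb, hZ, hiid]
  | succ s ih =>
    intro T u x hT
    by_cases hZ : x ∈ Z
    · simp [bword_succ, Avoids, avoidProb, hZ]
    have hnot : s + 1 ∉ T := fun h => lt_irrefl _ (hT _ h)
    have hne : ∀ t ∈ T, t ≠ s + 1 := fun t ht h => hnot (h ▸ ht)
    have h : {ω : ℕ → Ev I | ∀ t ∈ T, ω t = u t} ∩ {ω | Avoids g Z (bword ω (s + 1)) x} =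
        ⋃ a, ({ω | ∀ t ∈ insert (s + 1) T, ω t = Function.update u (s + 1) a t} ∩
          {ω | Avoids g Z (bword ω s) (g x a)}) := by
      ext ω
      simp only [Set.mem_inter_iff, Set.mem_ofPred_eq, Set.mem_iUnion, Finset.forall_mem_insert,
        Function.update_self, bword_succ, Avoids]
      have hu : ∀ a, (∀ t ∈ T, ω t = Function.update u (s + 1) a t) ↔ ∀ t ∈ T, ω t = u t :=
        fun a => forall₂_congr fun t ht => by rw [Function.update_of_ne (hne t ht)]
      simp only [hu]
      constructor
      · rintro ⟨h1, -, h2⟩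
        exact ⟨_, ⟨rfl, h1⟩, h2⟩
      · rintro ⟨a, ⟨rfl, h1⟩, h2⟩
        exact ⟨h1, hZ, h2⟩
    rw [h, measure_iUnion]
    · simp only [avoidProb, hZ, if_false, ← ENNReal.tsum_mul_left]
      refine tsum_congr fun a => ?_
      rw [ih, Finset.prod_insert hnot, Function.update_self]
      · rw [Finset.prod_congr rfl fun t ht => by rw [Function.update_of_ne (hne t ht)]]
        ring
      · intro t ht
        rcases Finset.mem_insert.1 ht with rfl | ht
        · exact Nat.lt_succ_self s
        · exact (Nat.lt_succ_self s).trans (hT t ht)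
    · intro a b hab
      refine Set.disjoint_left.2 fun ω h1 h2 => hab ?_
      have h1' := h1.1 (s + 1) (Finset.mem_insert_self _ _)
      have h2' := h2.1 (s + 1) (Finset.mem_insert_self _ _)
      simp only [Function.update_self] at h1' h2'
      exact h1'.symm.trans h2'
    · intro a
      refine MeasurableSet.inter ?_ (measurableSet_avoids g Z s _)
      have : {ω : ℕ → Ev I | ∀ t ∈ insert (s + 1) T, ω t = Function.update u (s + 1) a t} =
          ⋂ t ∈ insert (s + 1) T, (fun ω : ℕ → Ev I => ω t) ⁻¹'
            {Function.update u (s + 1) a t} := by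
        ext ω
        simp
      rw [this]
      exact Finset.measurableSet_biInter _ fun t _ =>
        measurable_pi_apply t (measurableSet_singleton _)

theorem tsum_prob_eq_one {I : ℕ} {p : Ev I → ℝ≥0∞} (P : Measure (ℕ → Ev I))
    [IsProbabilityMeasure P]
    (hiid : ∀ (T : Finset ℕ) (u : ℕ → Ev I), P {ω | ∀ t ∈ T, ω t = u t} = ∏ t ∈ T, p (u t)) :
    ∑' a, p a = 1 := by
  have h : ∀ a, p a = P ((fun ω : ℕ → Ev I => ω 0) ⁻¹' {a}) := by
    intro a
    have := hiid {0} fun _ => a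
    simp only [Finset.mem_singleton, forall_eq, Finset.prod_singleton] at this
    rw [← this]
    rfl
  rw [tsum_congr h, ← measure_iUnion]
  · rw [← Set.preimage_iUnion, Set.iUnion_of_singleton, Set.preimage_univ, measure_univ]
  · intro a b hab
    exact Disjoint.preimage _ (by simpa using hab)
  · exact fun a => measurable_pi_apply 0 (measurableSet_singleton a)

/-- The first time at which `Q` holds is at most the number of times at which it fails. -/
theorem sInf_time_le_tsum (Q : ℕ → Prop) (B : ℕ → ℝ≥0∞) (hB : ∀ t, ¬ Q t → 1 ≤ B t) :
    sInf {r : ℝ≥0∞ | ∃ t : ℕ, r = t ∧ Q t} ≤ ∑' t, B t := by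
  classical
  by_cases h : ∃ t, Q t
  · calc sInf {r : ℝ≥0∞ | ∃ t : ℕ, r = t ∧ Q t} ≤ (Nat.find h : ℕ) :=
          sInf_le ⟨_, rfl, Nat.find_spec h⟩
      _ = ∑ t ∈ Finset.range (Nat.find h), 1 := by simp
      _ ≤ ∑ t ∈ Finset.range (Nat.find h), B t :=
          Finset.sum_le_sum fun t ht => hB t (Nat.find_min h (Finset.mem_range.1 ht))
      _ ≤ ∑' t, B t := ENNReal.sum_le_tsum _
  · push Not at h
    calc _ ≤ (⊤ : ℝ≥0∞) := le_top
      _ = ∑' _ : ℕ, (1 : ℝ≥0∞) := (ENNReal.tsum_const_eq_top_of_ne_zero one_ne_zero).symm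
      _ ≤ ∑' t, B t := ENNReal.tsum_le_tsum fun t => hB t (h t)

theorem lintegral_time_le {I : ℕ} {σ : Type*} {p : Ev I → ℝ≥0∞} (P : Measure (ℕ → Ev I))
    (hiid : ∀ (T : Finset ℕ) (u : ℕ → Ev I), P {ω | ∀ t ∈ T, ω t = u t} = ∏ t ∈ T, p (u t))
    {g : σ → Ev I → σ} {Z S : Set σ} {V : σ → ℝ≥0∞} (hS : ∀ x ∈ S, ∀ a, g x a ∈ S)
    (hV : ∀ x ∈ S, x ∉ Z → 1 + ∑' a, p a * V (g x a) ≤ V x) {x : σ} (hx : x ∈ S)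
    {Q : (ℕ → Ev I) → ℕ → Prop} (hQ : ∀ ω t, ¬ Avoids g Z (bword ω t) x → Q ω t) :
    ∫⁻ ω, sInf {r : ℝ≥0∞ | ∃ t : ℕ, r = t ∧ Q ω t} ∂P ≤ V x := by
  calc _ ≤ ∫⁻ ω, ∑' t, {ω | Avoids g Z (bword ω t) x}.indicator (fun _ => (1 : ℝ≥0∞)) ω ∂P := by
        refine lintegral_mono fun ω => sInf_time_le_tsum _ _ fun t ht => ?_
        rw [Set.indicator_of_mem]
        exact not_not.1 fun h => ht (hQ ω t h)
    _ = ∑' t, avoidProb p g Z t x := by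
        rw [lintegral_tsum fun t =>
          (measurable_const.indicator (measurableSet_avoids g Z t x)).aemeasurable]
        refine tsum_congr fun t => ?_
        rw [lintegral_indicator_const (measurableSet_avoids g Z t x), one_mul]
        simpa [bword] using measure_cylinder_inter_avoids P hiid g Z t ∅ (fun _ => .d ∅) x
    _ ≤ V x := ENNReal.tsum_le_of_sum_range_le fun t => sum_avoidProb_le hS hV t x hx

/-- The one-dimensional dynamics of component `i` under `fP`. -/
noncomputable def step {I : ℕ} (C : Fin I → ℕ) (μ : Fin I → ℕ → ℝ) (ℓ : Fin I → ℕ → ℕ)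
    (i : Fin I) (x : ℕ) : Ev I → ℕ
  | .d A => x + if i ∈ A ∧ x < C i then 1 else 0
  | .s k j => if i = k ∧ μ i (ℓ i j) ≤ μ i x then x - 1 else x

theorem iter_fP_apply {I : ℕ} (C : Fin I → ℕ) (μ : Fin I → ℕ → ℝ) (ℓ : Fin I → ℕ → ℕ)
    (i : Fin I) : ∀ (w : List (Ev I)) (x : Fin I → ℕ),
      iter (fP C μ ℓ) x w i = iter (step C μ ℓ i) (x i) w
  | [], _ => rfl
  | a :: w, x => by
    simp only [iter]
    rw [iter_fP_apply C μ ℓ i w]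
    congr 1
    cases a with
    | d A => rfl
    | s k j =>
      by_cases h : i = k
      · subst h; rfl
      · simp [fP, step, h]

theorem step_le {I : ℕ} {C : Fin I → ℕ} {μ : Fin I → ℕ → ℝ} {ℓ : Fin I → ℕ → ℕ} {i : Fin I}
    {x : ℕ} (hx : x ≤ C i) (a : Ev I) : step C μ ℓ i x a ≤ C i := by
  cases a <;> simp only [step] <;> split_ifs <;> omega

theorem step_mono {I : ℕ} {C : Fin I → ℕ} {μ : Fin I → ℕ → ℝ} {ℓ : Fin I → ℕ → ℕ} {i : Fin I}
    {x y : ℕ} (hxy : x ≤ y) (hy : y ≤ C i) (a : Ev I) :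
    step C μ ℓ i x a ≤ step C μ ℓ i y a := by
  cases a with
  | d A => simp only [step]; split_ifs <;> grind
  | s k j =>
    rcases hxy.eq_or_lt with rfl | h
    · rfl
    · simp only [step]; split_ifs <;> omega

/-- Indicator of the arrivals that increment component `i` below capacity. -/
def upInd {I : ℕ} (i : Fin I) : Ev I → ℝ≥0∞
  | .d A => if i ∈ A then 1 else 0
  | .s _ _ => 0

/-- Indicator of the services that decrement component `i` when it is in state `x`. -/
noncomputable def downInd {I : ℕ} (μ : Fin I → ℕ → ℝ) (ℓ : Fin I → ℕ → ℕ) (i : Fin I) (x : ℕ) :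
    Ev I → ℝ≥0∞
  | .d _ => 0
  | .s k j => if i = k ∧ μ i (ℓ i j) ≤ μ i x then 1 else 0

theorem tsum_probA_mul_upInd {I : ℕ} {C : Fin I → ℕ} {μ : Fin I → ℕ → ℝ} {ℓ : Fin I → ℕ → ℕ}
    {lam : Finset (Fin I) → ℝ} {Λ : ℝ} (hlam : ∀ A, 0 ≤ lam A) (hΛ : 0 < Λ) (i : Fin I) :
    ∑' a, probA C μ ℓ lam Λ a * upInd i a =
      ENNReal.ofReal ((∑ A ∈ Finset.univ.filter (fun A => i ∈ A), lam A) / Λ) := by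
  rw [tsum_ev, Finset.sum_div, ENNReal.ofReal_sum_of_nonneg
    fun A _ => div_nonneg (hlam A) hΛ.le, Finset.sum_filter]
  simp only [upInd, mul_zero, tsum_zero, Finset.sum_const_zero, add_zero]
  refine Finset.sum_congr rfl fun A _ => ?_
  by_cases h : i ∈ A
  · have : A.Nonempty := ⟨i, h⟩
    simp [probA, h, this]
  · simp [h]

theorem sum_increments_eq {a : ℕ → ℝ} {m N : ℕ} (hm : m ≤ N) (ha : ∀ j < N, a j ≤ a (j + 1)) :
    ∀ M ≤ N, ∑ j ∈ Finset.Icc 1 M, (if a j ≤ a m then a j - a (j - 1) else 0) =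
      a (min M m) - a 0 := by
  have hmono : ∀ k j, k ≤ j → j ≤ N → a k ≤ a j := by
    intro k j hkj
    induction j, hkj using Nat.le_induction with
    | base => intro _; exact le_rfl
    | succ j _ ih => intro hj; exact (ih (by omega)).trans (ha j (by omega))
  intro M
  induction M with
  | zero => simp
  | succ M ih =>
    intro hM
    rw [Finset.sum_Icc_succ_top (by omega), ih (by omega), Nat.add_sub_cancel]
    rcases Nat.lt_or_ge M m with h | h
    · rw [if_pos (hmono _ _ (by omega) hm), min_eq_left h.le, min_eq_left (by omega)]
      ring
    · rw [min_eq_right h, min_eq_right (by omega)]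
      have h1 := hmono m M h (by omega)
      have h2 := ha M (by omega)
      split_ifs <;> linarith

theorem tsum_probA_mul_downInd {I : ℕ} {C : Fin I → ℕ} {μ : Fin I → ℕ → ℝ} {ℓ : Fin I → ℕ → ℕ}
    {lam : Finset (Fin I) → ℝ} {Λ : ℝ} (hΛ : 0 < Λ) (i : Fin I) (hμ0 : μ i 0 = 0)
    (hμnn : ∀ k, k ≤ C i → 0 ≤ μ i k) (hℓ : Set.BijOn (ℓ i) (Set.Iic (C i)) (Set.Iic (C i)))
    (hsort : ∀ j, j < C i → μ i (ℓ i j) ≤ μ i (ℓ i (j + 1))) {x : ℕ} (hx : x ≤ C i) :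
    ∑' a, probA C μ ℓ lam Λ a * downInd μ ℓ i x a = ENNReal.ofReal (μ i x / Λ) := by
  obtain ⟨m, hm, rfl⟩ := hℓ.surjOn hx
  obtain ⟨n, hn, hn0⟩ := hℓ.surjOn (Set.mem_Iic.2 (Nat.zero_le (C i)))
  have hsum := sum_increments_eq (a := fun j => μ i (ℓ i j)) (Set.mem_Iic.1 hm) hsort (C i) le_rfl
  have hsum0 := sum_increments_eq (a := fun j => μ i (ℓ i j)) (Set.mem_Iic.1 hn) hsort (C i) le_rfl
  have hinc : ∀ b : ℝ, ∀ j ∈ Finset.Icc 1 (C i),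
      0 ≤ if μ i (ℓ i j) ≤ b then μ i (ℓ i j) - μ i (ℓ i (j - 1)) else 0 := by
    intro b j hj
    rw [Finset.mem_Icc] at hj
    have := hsort (j - 1) (by omega)
    rw [Nat.sub_add_cancel hj.1] at this
    split_ifs <;> linarith
  have hzero : μ i (ℓ i 0) = 0 := by
    have h1 := hμnn (ℓ i 0) (hℓ.mapsTo (Set.mem_Iic.2 (Nat.zero_le (C i))))
    have h2 := Finset.sum_nonneg (hinc (μ i (ℓ i n)))
    rw [hsum0, min_eq_right (Set.mem_Iic.1 hn), hn0, hμ0] at h2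
    linarith
  rw [min_eq_right (Set.mem_Iic.1 hm), hzero, sub_zero] at hsum
  rw [tsum_ev, ← hsum, Finset.sum_div, ENNReal.ofReal_sum_of_nonneg
    fun j hj => div_nonneg (hinc _ j hj) hΛ.le]
  simp only [downInd, mul_zero, Finset.sum_const_zero, zero_add]
  rw [Finset.sum_eq_single i (fun k _ hk => by simp [hk.symm]) (by simp),
    tsum_eq_sum (s := Finset.Icc 1 (C i))]
  · refine Finset.sum_congr rfl fun j hj => ?_
    rw [Finset.mem_Icc] at hj
    simp only [probA, hj, and_self, if_true, true_and]
    split_ifs <;> simp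
  · intro j hj
    rw [Finset.mem_Icc] at hj
    simp [probA, hj]

/-- If each letter moves `V` up by at most `K` times the `r`-indicator and down by at least `K`
times the `l`-indicator, the mean one-step decrease of `V` is at least one. -/
theorem one_add_tsum_le {E : Type*} {p l r v : E → ℝ≥0∞} {v₀ : ℝ≥0∞} {b c Λ : ℝ}
    (hp : ∑' a, p a = 1) (hΛ : 0 < Λ) (hc : 0 ≤ c) (hcb : c < b)
    (hl : ENNReal.ofReal (b / Λ) ≤ ∑' a, p a * l a)
    (hr : ∑' a, p a * r a ≤ ENNReal.ofReal (c / Λ))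
    (hv : ∀ a, v a + ENNReal.ofReal (Λ / (b - c)) * l a ≤
      v₀ + ENNReal.ofReal (Λ / (b - c)) * r a) :
    1 + ∑' a, p a * v a ≤ v₀ := by
  set K := ENNReal.ofReal (Λ / (b - c)) with hK
  have hbc : 0 < b - c := sub_pos.2 hcb
  have hsum : ∑' a, p a * v a + K * ∑' a, p a * l a ≤ v₀ + K * ∑' a, p a * r a := by
    calc _ = ∑' a, p a * (v a + K * l a) := by
          rw [← ENNReal.tsum_mul_left, ← ENNReal.tsum_add]
          exact tsum_congr fun a => by ring
      _ ≤ ∑' a, p a * (v₀ + K * r a) :=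
          ENNReal.tsum_le_tsum fun a => mul_le_mul_right (hv a) _
      _ = ∑' a, (p a * v₀ + K * (p a * r a)) := tsum_congr fun a => by ring
      _ = _ := by
          rw [ENNReal.tsum_add, ENNReal.tsum_mul_right, ENNReal.tsum_mul_left, hp, one_mul]
  have hKb : K * ENNReal.ofReal (b / Λ) = 1 + K * ENNReal.ofReal (c / Λ) := by
    rw [hK, ← ENNReal.ofReal_mul (by positivity), ← ENNReal.ofReal_mul (by positivity),
      ← ENNReal.ofReal_one, ← ENNReal.ofReal_add zero_le_one (by positivity)]
    congr 1
    field_simp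
    ring
  have hfin : K * ENNReal.ofReal (c / Λ) ≠ ⊤ := by
    rw [hK]; exact ENNReal.mul_ne_top ENNReal.ofReal_ne_top ENNReal.ofReal_ne_top
  refine (ENNReal.add_le_add_iff_right hfin).1 ?_
  calc 1 + ∑' a, p a * v a + K * ENNReal.ofReal (c / Λ)
      = ∑' a, p a * v a + K * ENNReal.ofReal (b / Λ) := by rw [hKb]; ring
    _ ≤ ∑' a, p a * v a + K * ∑' a, p a * l a := by gcongr
    _ ≤ v₀ + K * ∑' a, p a * r a := hsum
    _ ≤ v₀ + K * ENNReal.ofReal (c / Λ) := by gcongr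

theorem step_add_downInd_le {I : ℕ} {C : Fin I → ℕ} {μ : Fin I → ℕ → ℝ} {ℓ : Fin I → ℕ → ℕ}
    {i : Fin I} {x : ℕ} (hx : x ≠ 0) (a : Ev I) :
    (step C μ ℓ i x a : ℝ≥0∞) + downInd μ ℓ i x a ≤ x + upInd i a := by
  cases a with
  | d A =>
    simp only [step, downInd, upInd, add_zero]
    by_cases h : i ∈ A <;> by_cases h' : x < C i <;> simp [h, h']
  | s k j =>
    simp only [step, downInd, upInd, add_zero]
    split_ifs
    · exact_mod_cast (by omega : x - 1 + 1 ≤ x)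
    · simp

theorem sub_step_add_upInd_le {I : ℕ} {C : Fin I → ℕ} {μ : Fin I → ℕ → ℝ} {ℓ : Fin I → ℕ → ℕ}
    {i : Fin I} {x : ℕ} (hx : x < C i) (a : Ev I) :
    ((C i - step C μ ℓ i x a : ℕ) : ℝ≥0∞) + upInd i a ≤ (C i - x : ℕ) + downInd μ ℓ i x a := by
  cases a with
  | d A =>
    simp only [step, downInd, upInd, add_zero, hx, and_true]
    split_ifs
    · exact_mod_cast (by omega : C i - (x + 1) + 1 ≤ C i - x)
    · simp
  | s k j =>
    simp only [step, downInd, upInd, add_zero]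
    split_ifs
    · exact_mod_cast (by omega : C i - (x - 1) ≤ C i - x + 1)
    · simp

/-- Component `i` couples as soon as the trajectory from an extremal state `y` visits `Z`. -/
theorem exists_image_eq_singleton {I : ℕ} {C : Fin I → ℕ} {μ : Fin I → ℕ → ℝ}
    {ℓ : Fin I → ℕ → ℕ} {i : Fin I} {Z : Set ℕ} {r : ℕ → ℕ → Prop}
    (hr : ∀ x y a, r x y → r (step C μ ℓ i x a) (step C μ ℓ i y a))
    (hZ : ∀ x y, r x y → y ∈ Z → x = y) {y : ℕ} (hy : y ≤ C i) (hry : ∀ x ≤ C i, r x y)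
    (w : List (Ev I)) (hw : ¬ Avoids (step C μ ℓ i) Z w y) :
    ∃ c : ℕ, (fun x => iter (fP C μ ℓ) x w i) '' Xspace C = {c} := by
  refine ⟨iter (step C μ ℓ i) y w, Set.eq_singleton_iff_unique_mem.2 ⟨?_, ?_⟩⟩
  · refine ⟨Function.update 0 i y, fun k => ?_, ?_⟩
    · by_cases hk : k = i
      · subst hk; simpa using hy
      · simp [hk]
    · simp [iter_fP_apply]
  · rintro _ ⟨x, hx, rfl⟩
    simp only [iter_fP_apply]
    exact iter_eq_of_not_avoids hr hZ w _ _ (hry _ (hx i)) hw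

/-- Lemma 3.3: per-component coupling-time bounds for ATO-POS. -/
theorem stmt3 (I : ℕ) (hI : 1 ≤ I) (C : Fin I → ℕ) (hC : ∀ i, 1 ≤ C i)
    (μ : Fin I → ℕ → ℝ) (hμ0 : ∀ i, μ i 0 = 0) (hμnn : ∀ i k, k ≤ C i → 0 ≤ μ i k)
    (ℓ : Fin I → ℕ → ℕ) (hℓ : ∀ i, Set.BijOn (ℓ i) (Set.Iic (C i)) (Set.Iic (C i)))
    (hsort : ∀ i j, j < C i → μ i (ℓ i j) ≤ μ i (ℓ i (j + 1)))
    (lam : Finset (Fin I) → ℝ) (hlamnn : ∀ A, 0 ≤ lam A) (hlam0 : lam ∅ = 0)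
    (β : Fin I → ℝ) (hβ : ∀ i, IsGreatest (μ i '' Set.Iic (C i)) (β i))
    (Λ : ℝ) (hΛ : Λ = (∑ A : Finset (Fin I), lam A) + ∑ i, β i) (hΛpos : 0 < Λ)
    (lamI : Fin I → ℝ)
    (hlamI : ∀ i, lamI i = ∑ A ∈ Finset.univ.filter (fun A => i ∈ A), lam A)
    (P : Measure (ℕ → Ev I)) [IsProbabilityMeasure P]
    (hiid : ∀ (T : Finset ℕ) (u : ℕ → Ev I),
        P {ω | ∀ t ∈ T, ω t = u t} = ∏ t ∈ T, probA C μ ℓ lam Λ (u t))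
    (i : Fin I) (αi ηi : ℝ)
    (hα : IsLeast (μ i '' Set.Icc 1 (C i)) αi)
    (hη1 : C i = 1 → ηi = 0)
    (hη2 : 2 ≤ C i → IsGreatest (μ i '' Set.Icc 1 (C i - 1)) ηi) :
    ((lamI i < αi →
      ∫⁻ ω, sInf {r : ℝ≥0∞ | ∃ t : ℕ, r = t ∧
          ∃ c : ℕ, (fun x => iter (fP C μ ℓ) x (bword ω t) i) '' Xspace C = {c}} ∂P
        ≤ ENNReal.ofReal (Λ * C i / (αi - lamI i)))
    ∧ (ηi < lamI i →
      ∫⁻ ω, sInf {r : ℝ≥0∞ | ∃ t : ℕ, r = t ∧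
          ∃ c : ℕ, (fun x => iter (fP C μ ℓ) x (bword ω t) i) '' Xspace C = {c}} ∂P
        ≤ ENNReal.ofReal (Λ * C i / (lamI i - ηi)))) := by
  have hp := tsum_prob_eq_one P hiid
  have hU := tsum_probA_mul_upInd (C := C) (μ := μ) (ℓ := ℓ) hlamnn hΛpos i
  rw [← hlamI] at hU
  have hD : ∀ x ≤ C i, _ := fun x hx => tsum_probA_mul_downInd (lam := lam) hΛpos i (hμ0 i)
    (hμnn i) (hℓ i) (hsort i) hx
  have hS : ∀ x ∈ Set.Iic (C i), ∀ a, step C μ ℓ i x a ∈ Set.Iic (C i) :=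
    fun x hx a => step_le hx a
  constructor
  · intro hlt
    have hlnn : 0 ≤ lamI i := by
      rw [hlamI]
      exact Finset.sum_nonneg fun A _ => hlamnn A
    have key := lintegral_time_le P hiid (g := step C μ ℓ i) (Z := {0}) (S := Set.Iic (C i))
      (V := fun x => ENNReal.ofReal (Λ / (αi - lamI i)) * x) hS ?_ (x := C i)
      (Set.mem_Iic.2 le_rfl)
      fun ω t => exists_image_eq_singleton (r := fun x y => x ≤ y ∧ y ≤ C i)
        (fun x y a h => ⟨step_mono h.1 h.2 a, step_le h.2 a⟩)
        (fun x y h hy => by rw [Set.mem_singleton_iff] at hy; omega) le_rfl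
        (fun x hx => ⟨hx, le_rfl⟩) (bword ω t)
    · refine key.trans_eq ?_
      rw [← ENNReal.ofReal_natCast,
        ← ENNReal.ofReal_mul (div_nonneg hΛpos.le (sub_pos.2 hlt).le), div_mul_eq_mul_div]
    · intro x hx hx0
      refine one_add_tsum_le (l := downInd μ ℓ i x) (r := upInd i) hp hΛpos hlnn hlt ?_ hU.le ?_
      · rw [hD x hx]
        gcongr
        exact hα.2 ⟨x, ⟨Nat.one_le_iff_ne_zero.2 hx0, hx⟩, rfl⟩
      · intro a
        rw [← mul_add, ← mul_add]
        exact mul_le_mul_right (step_add_downInd_le hx0 a) _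
  · intro hlt
    have hη : 0 ≤ ηi ∧ ∀ x < C i, μ i x ≤ ηi := by
      rcases (hC i).eq_or_lt with h | h
      · rw [hη1 h.symm]
        refine ⟨le_rfl, fun x hx => ?_⟩
        rw [(by omega : x = 0), hμ0]
      · have hmax := (hη2 h).2
        have h0 : 0 ≤ ηi := (hμnn i 1 h.le).trans (hmax ⟨1, ⟨le_rfl, by omega⟩, rfl⟩)
        refine ⟨h0, fun x hx => ?_⟩
        rcases Nat.eq_zero_or_pos x with rfl | hx0
        · rwa [hμ0]
        · exact hmax ⟨x, ⟨hx0, by omega⟩, rfl⟩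
    have key := lintegral_time_le P hiid (g := step C μ ℓ i) (Z := {C i}) (S := Set.Iic (C i))
      (V := fun x => ENNReal.ofReal (Λ / (lamI i - ηi)) * (C i - x : ℕ)) hS ?_ (x := 0)
      (Nat.zero_le _)
      fun ω t => exists_image_eq_singleton (r := fun x y => y ≤ x ∧ x ≤ C i)
        (fun x y a h => ⟨step_mono h.1 h.2 a, step_le h.2 a⟩)
        (fun x y h hy => by rw [Set.mem_singleton_iff] at hy; omega) (Nat.zero_le _)
        (fun x hx => ⟨Nat.zero_le _, hx⟩) (bword ω t)
    · refine key.trans_eq ?_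
      rw [Nat.sub_zero, ← ENNReal.ofReal_natCast,
        ← ENNReal.ofReal_mul (div_nonneg hΛpos.le (sub_pos.2 hlt).le), div_mul_eq_mul_div]
    · intro x hx hxC
      have hxlt : x < C i := lt_of_le_of_ne hx hxC
      refine one_add_tsum_le (l := upInd i) (r := downInd μ ℓ i x) hp hΛpos hη.1 hlt hU.ge ?_ ?_
      · rw [hD x hx]
        gcongr
        exact hη.2 x hxlt
      · intro a
        rw [← mul_add, ← mul_add]
        exact mul_le_mul_right (sub_step_add_upInd_le hxlt a) _

end ATO
end

section
/- Stopping time of the modified aggregated-envelope algorithm (Theorem 5): suppose {1,…,I} = I_0 ∪ I_C with (i) μ > Σ_{i∈I_0} λ_i, (ii) δ_p := λ_p − μ(Σ_{i=1}^{p} C_i − 1) > 0 for every p ∈ I_C, and (iii) whenever i ∈ I_0 and j ∈ I_C then i ≤ j. Let [m_s, M_s] = F([0, C], u_1⋯u_s) be the aggregated-envelope trajectory started from the bottom state 0 = (0,…,0) and the top state C = (C_1,…,C_I), and let τ_Alg = min{t ≥ 0 : for every p ∈ {1,…,I} there exists s ≤ t with (m_s)_p = (M_s)_p} be the first time every component has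 coupled at least once. Then E[τ_Alg] ≤ (Λ/(μ − Σ_{i∈I_0} λ_i))·Σ_{i∈I_0} C_i + Σ_{p∈I_C} Λ C_p/δ_p. -/
open MeasureTheory Finset ENNReal

namespace ATO

/-- The detailed state space `N`: coordinates indexed by the nonempty subsets `A`
(the `∅` coordinate is forced to `0`), with `∑_{A ∋ i} n_A ≤ C_i` for every `i`. -/
def Nspace {I : ℕ} (C : Fin I → ℕ) : Set (Finset (Fin I) → ℕ) :=
  {n | n ∅ = 0 ∧ ∀ i, (∑ A ∈ Finset.univ.filter (fun A => i ∈ A), n A) ≤ C i}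

/-- The projection `ψ : N → X`, `ψ(n)_i = ∑_{A ∋ i} n_A`. -/
def psi {I : ℕ} (n : Finset (Fin I) → ℕ) : Fin I → ℕ :=
  fun i => ∑ A ∈ Finset.univ.filter (fun A => i ∈ A), n A

/-- The enumeration `A_k^i` of the subsets of `{i,…,I}` containing `i` (0-based indices):
an element `t > i` belongs to `A_k^i` iff the binary digit of `k` in position `I - 1 - t`
vanishes. -/
def Aset {I : ℕ} (i : Fin I) (k : ℕ) : Finset (Fin I) :=
  Finset.univ.filter (fun t => t = i ∨ (i < t ∧ Nat.testBit k (I - 1 - t.val) = false))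

/-- Partial sums `∑_{ℓ=0}^{k-1} n_{A_ℓ^i}`. -/
def psum {I : ℕ} (i : Fin I) (n : Finset (Fin I) → ℕ) (k : ℕ) : ℕ :=
  ∑ l ∈ Finset.range k, n (Aset i l)

/-- The transition function `f̃` of the detailed chain: a demand `d A` adds `ε_{A^{(n)}}`
where `A^{(n)} = {i ∈ A : ψ(n)_i < C_i}` (no change if `A^{(n)} = ∅`); a service `r_j^i`
removes `ε_{A_k^i}` for the minimal `k` with `∑_{ℓ=0}^{k} n_{A_ℓ^i} ≥ j`, if
`∑_{ℓ} n_{A_ℓ^i} ≥ j`, and otherwise does nothing. -/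
noncomputable def ftil {I : ℕ} (C : Fin I → ℕ) (n : Finset (Fin I) → ℕ) :
    Ev I → (Finset (Fin I) → ℕ)
  | .d A => fun B =>
      n B + if B = A.filter (fun i => psi n i < C i) ∧ B.Nonempty then 1 else 0
  | .s i j => fun B =>
      n B - if j ≤ psum i n (2 ^ (I - 1 - i.val))
              ∧ B = Aset i (sInf {k | j ≤ psum i n (k + 1)}) then 1 else 0

/-- The supremum chain `f̄` on `X` (componentwise supremum over all detailed states
projecting to `x`). -/
noncomputable def fbar {I : ℕ} (C : Fin I → ℕ) (x : Fin I → ℕ) (a : Ev I) : Fin I → ℕ :=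
  fun p => sSup ((fun n => psi (ftil C n a) p) '' {n | n ∈ Nspace C ∧ psi n = x})

/-- The infimum chain `f_inf` on `X` (componentwise infimum over all detailed states
projecting to `x`). -/
noncomputable def finf {I : ℕ} (C : Fin I → ℕ) (x : Fin I → ℕ) (a : Ev I) : Fin I → ℕ :=
  fun p => sInf ((fun n => psi (ftil C n a) p) '' {n | n ∈ Nspace C ∧ psi n = x})

/-- One step of the aggregated envelope chain `F([m,M],a)`. -/
noncomputable def Fenv {I : ℕ} (C : Fin I → ℕ) (m M : Fin I → ℕ) (a : Ev I) :
    (Fin I → ℕ) × (Fin I → ℕ) :=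
  (fun p => sInf ((fun x => finf C x a p) '' Set.Icc m M),
   fun p => sSup ((fun x => fbar C x a p) '' Set.Icc m M))

/-- Iteration of the aggregated envelope chain along a word (head applied first). -/
noncomputable def FenvIter {I : ℕ} (C : Fin I → ℕ) :
    (Fin I → ℕ) → (Fin I → ℕ) → List (Ev I) → (Fin I → ℕ) × (Fin I → ℕ)
  | m, M, [] => (m, M)
  | m, M, a :: w => FenvIter C (Fenv C m M a).1 (Fenv C m M a).2 w

/-- The "hat" operation `x̂_i = max{x_i − (x_1 + ⋯ + x_{i-1}), 0}`. -/
def xhat {I : ℕ} (x : Fin I → ℕ) (i : Fin I) : ℕ :=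
  x i - ∑ t ∈ Finset.univ.filter (fun t => t < i), x t

/-- The distribution `ν` on events: `ν (d A) = λ_A / Λ` and `ν (r_j^i) = μ / Λ`. -/
noncomputable def probJ {I : ℕ} (C : Fin I → ℕ) (lam : Finset (Fin I) → ℝ) (μv Λ : ℝ) :
    Ev I → ℝ≥0∞
  | .d A => if A.Nonempty then ENNReal.ofReal (lam A / Λ) else 0
  | .s i j => if 1 ≤ j ∧ j ≤ C i then ENNReal.ofReal (μv / Λ) else 0

theorem psi_ftil_d {I : ℕ} (C : Fin I → ℕ) (n : Finset (Fin I) → ℕ) (A : Finset (Fin I))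
    (p : Fin I) :
    psi (ftil C n (.d A)) p = psi n p + if p ∈ A ∧ psi n p < C p then 1 else 0 := by
  have h : psi (ftil C n (.d A)) p = psi n p +
      ∑ B ∈ Finset.univ.filter (fun B : Finset (Fin I) => p ∈ B),
        if B = A.filter (fun i => psi n i < C i) ∧ B.Nonempty then 1 else 0 := by
    simp only [psi, ftil, Finset.sum_add_distrib]
  rw [h]
  congr 1
  split_ifs with hp
  · have hmem : p ∈ A.filter (fun i => psi n i < C i) := by simpa using hp
    rw [Finset.sum_eq_single (A.filter (fun i => psi n i < C i))]
    · rw [if_pos ⟨rfl, ⟨p, hmem⟩⟩]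
    · intro B _ hB
      rw [if_neg (fun h => hB h.1)]
    · intro h
      simp [hmem] at h
  · refine Finset.sum_eq_zero fun B hB => if_neg ?_
    rintro ⟨rfl, -⟩
    exact hp (by simpa using hB)

theorem psi_ftil_s_le {I : ℕ} (C : Fin I → ℕ) (n : Finset (Fin I) → ℕ) (i : Fin I) (j : ℕ)
    (p : Fin I) : psi (ftil C n (.s i j)) p ≤ psi n p :=
  Finset.sum_le_sum fun _ _ => Nat.sub_le _ _

theorem psi_le_psi_ftil_s_add_one {I : ℕ} (C : Fin I → ℕ) (n : Finset (Fin I) → ℕ) (i : Fin I)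
    (j : ℕ) (p : Fin I) : psi n p ≤ psi (ftil C n (.s i j)) p + 1 := by
  set B₀ := Aset i (sInf {k | j ≤ psum i n (k + 1)})
  calc psi n p ≤ ∑ B ∈ Finset.univ.filter (fun B : Finset (Fin I) => p ∈ B),
        (ftil C n (.s i j) B + if B = B₀ then 1 else 0) := by
        refine Finset.sum_le_sum fun B _ => ?_
        simp only [ftil]
        split_ifs with h1 h2
        · omega
        · exact absurd h1.2 h2
        · omega
        · omega
    _ ≤ _ := by
        rw [Finset.sum_add_distrib]
        refine Nat.add_le_add le_rfl ?_
        rw [Finset.sum_ite_eq']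
        split_ifs <;> simp

theorem psi_ftil_s_of_lt {I : ℕ} (C : Fin I → ℕ) (n : Finset (Fin I) → ℕ) {i p : Fin I}
    (j : ℕ) (hp : p < i) : psi (ftil C n (.s i j)) p = psi n p := by
  refine Finset.sum_congr rfl fun B hB => ?_
  simp only [ftil]
  rw [if_neg, Nat.sub_zero]
  rintro ⟨-, rfl⟩
  simp only [Aset, Finset.mem_filter, Finset.mem_univ, true_and] at hB
  rcases hB with rfl | ⟨h, -⟩
  · exact lt_irrefl _ hp
  · exact lt_asymm h hp

theorem mem_Aset_self {I : ℕ} (i : Fin I) (k : ℕ) : i ∈ Aset i k := by simp [Aset]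

theorem Aset_injOn {I : ℕ} (i : Fin I) :
    Set.InjOn (Aset i) (Finset.range (2 ^ (I - 1 - i.val)) : Set ℕ) := by
  intro k hk l hl h
  simp only [Finset.coe_range, Set.mem_Iio] at hk hl
  refine Nat.eq_of_testBit_eq fun b => ?_
  by_cases hb : b < I - 1 - i.val
  · have ht : I - 1 - b < I := by omega
    have hm := congrArg (fun S => (⟨I - 1 - b, ht⟩ : Fin I) ∈ S) h
    have hne : (⟨I - 1 - b, ht⟩ : Fin I) ≠ i := by
      intro he
      have := congrArg Fin.val he
      simp only at this
      omega
    have hlt : i < (⟨I - 1 - b, ht⟩ : Fin I) := by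
      rw [Fin.lt_def]
      simp only
      omega
    have hb' : I - 1 - (I - 1 - b) = b := by omega
    simp only [Aset, Finset.mem_filter, Finset.mem_univ, true_and, hne, false_or, hlt, hb',
      eq_iff_iff] at hm
    cases h1 : k.testBit b <;> cases h2 : l.testBit b <;> simp_all
  · have hp : 2 ^ (I - 1 - i.val) ≤ 2 ^ b := Nat.pow_le_pow_right (by norm_num) (by omega)
    rw [Nat.testBit_lt_two_pow (hk.trans_le hp), Nat.testBit_lt_two_pow (hl.trans_le hp)]

theorem exists_eq_Aset {I : ℕ} (i : Fin I) (A : Finset (Fin I)) (hi : i ∈ A)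
    (hmin : ∀ t ∈ A, i ≤ t) : ∃ k < 2 ^ (I - 1 - i.val), A = Aset i k := by
  classical
  obtain ⟨k, hk, hbit⟩ : ∃ k < 2 ^ (I - 1 - i.val), ∀ b < I - 1 - i.val,
      (k.testBit b = false ↔ ∃ t ∈ A, t.val = I - 1 - b) := by
    refine ⟨(BitVec.ofFnLE fun b : Fin (I - 1 - i.val) =>
      decide (¬ ∃ t ∈ A, t.val = I - 1 - b.val)).toNat, BitVec.isLt _, fun b hb => ?_⟩
    rw [BitVec.testBit_toNat, BitVec.getLsbD_eq_getElem hb, BitVec.getElem_ofFnLE]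
    simp
  refine ⟨k, hk, ?_⟩
  ext t
  simp only [Aset, Finset.mem_filter, Finset.mem_univ, true_and]
  constructor
  · intro ht
    rcases eq_or_lt_of_le (hmin t ht) with h | h
    · exact Or.inl h.symm
    · refine Or.inr ⟨h, (hbit _ ?_).2 ⟨t, ht, ?_⟩⟩ <;> rw [Fin.lt_def] at h <;> omega
  · rintro (rfl | ⟨h, hb⟩)
    · exact hi
    · rw [Fin.lt_def] at h
      obtain ⟨t', ht', he⟩ := (hbit _ (by omega)).1 hb
      have : t' = t := Fin.ext (by omega)
      exact this ▸ ht'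

theorem psum_le_psi {I : ℕ} (n : Finset (Fin I) → ℕ) (i : Fin I) :
    psum i n (2 ^ (I - 1 - i.val)) ≤ psi n i := by
  classical
  rw [psum, ← Finset.sum_image (f := n) (g := Aset i) (Aset_injOn i)]
  refine Finset.sum_le_sum_of_subset fun B hB => ?_
  obtain ⟨k, -, rfl⟩ := Finset.mem_image.1 hB
  simp [mem_Aset_self]

theorem psi_le_psum {I : ℕ} (n : Finset (Fin I) → ℕ) (i : Fin I)
    (h0 : ∀ t < i, psi n t = 0) : psi n i ≤ psum i n (2 ^ (I - 1 - i.val)) := by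
  classical
  rw [psum, ← Finset.sum_image (f := n) (g := Aset i) (Aset_injOn i)]
  refine Finset.sum_le_sum_of_ne_zero fun B hB hne => ?_
  obtain ⟨k, hk, rfl⟩ := exists_eq_Aset i B (by simpa using hB) fun t ht => by
    by_contra! hlt
    exact hne (Finset.sum_eq_zero_iff.1 (h0 t hlt) B (by simpa using ht))
  exact Finset.mem_image_of_mem _ (Finset.mem_range.2 hk)

theorem psi_ftil_s_self_of_lt {I : ℕ} (C : Fin I → ℕ) (n : Finset (Fin I) → ℕ) (i : Fin I)
    {j : ℕ} (hj : psi n i < j) : psi (ftil C n (.s i j)) i = psi n i := by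
  refine Finset.sum_congr rfl fun B _ => ?_
  simp only [ftil]
  rw [if_neg, Nat.sub_zero]
  rintro ⟨h, -⟩
  have := psum_le_psi n i
  omega

theorem psi_ftil_s_self_add_one_le {I : ℕ} (C : Fin I → ℕ) (n : Finset (Fin I) → ℕ) (i : Fin I)
    {j : ℕ} (h0 : ∀ t < i, psi n t = 0) (hj1 : 1 ≤ j) (hj : j ≤ psi n i) :
    psi (ftil C n (.s i j)) i + 1 ≤ psi n i := by
  have hps : j ≤ psum i n (2 ^ (I - 1 - i.val)) := hj.trans (psi_le_psum n i h0)
  have hne : {k | j ≤ psum i n (k + 1)}.Nonempty := by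
    refine ⟨2 ^ (I - 1 - i.val) - 1, ?_⟩
    have : 1 ≤ 2 ^ (I - 1 - i.val) := Nat.one_le_two_pow
    simpa [Nat.sub_add_cancel this] using hps
  set k := sInf {k | j ≤ psum i n (k + 1)} with hk
  have hmem : j ≤ psum i n (k + 1) := Nat.sInf_mem hne
  have hlt : psum i n k < j := by
    rcases Nat.eq_zero_or_pos k with h | h
    · rw [h]
      simpa [psum] using Nat.succ_le_iff.1 hj1
    · by_contra! hle
      have : k ≤ k - 1 := Nat.sInf_le (by simpa [Nat.sub_add_cancel h] using hle)
      omega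
  have hpos : 1 ≤ n (Aset i k) := by
    have : psum i n (k + 1) = psum i n k + n (Aset i k) := Finset.sum_range_succ _ _
    omega
  refine Nat.succ_le_of_lt (Finset.sum_lt_sum (fun _ _ => Nat.sub_le _ _)
    ⟨Aset i k, by simp [mem_Aset_self], ?_⟩)
  simp only [ftil]
  rw [if_pos ⟨hps, rfl⟩]
  omega

theorem psi_ftil_le {I : ℕ} {C : Fin I → ℕ} {n : Finset (Fin I) → ℕ} (hn : n ∈ Nspace C)
    (a : Ev I) (p : Fin I) : psi (ftil C n a) p ≤ C p := by
  have hp : psi n p ≤ C p := hn.2 p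
  cases a with
  | d A =>
    rw [psi_ftil_d]
    split_ifs with h <;> omega
  | s i j => exact (psi_ftil_s_le C n i j p).trans hp

theorem exists_mem_Nspace {I : ℕ} {C x : Fin I → ℕ} (hx : x ≤ C) :
    {n | n ∈ Nspace C ∧ psi n = x}.Nonempty := by
  set n : Finset (Fin I) → ℕ := fun B => ∑ i, if B = {i} then x i else 0 with hn
  have hpsi : psi n = x := by
    funext p
    simp only [psi, hn]
    rw [Finset.sum_comm]
    simp [Finset.sum_ite_eq']
  refine ⟨n, ⟨?_, fun i => ?_⟩, hpsi⟩
  · exact Finset.sum_eq_zero fun i _ => if_neg (Finset.singleton_ne_empty i).symm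
  · exact (congrFun hpsi i).le.trans (hx i)

theorem Fenv_snd_le {I : ℕ} {C m M : Fin I → ℕ} {a : Ev I} {p : Fin I} {K : ℕ}
    (h : ∀ n ∈ Nspace C, m ≤ psi n → psi n ≤ M → psi (ftil C n a) p ≤ K) :
    (Fenv C m M a).2 p ≤ K := by
  refine csSup_le' ?_
  rintro _ ⟨x, hx, rfl⟩
  refine csSup_le' ?_
  rintro _ ⟨n, ⟨hn, rfl⟩, rfl⟩
  exact h n hn hx.1 hx.2

theorem le_Fenv_fst {I : ℕ} {C m M : Fin I → ℕ} (hmM : m ≤ M) (hMC : M ≤ C) {a : Ev I}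
    {p : Fin I} {K : ℕ}
    (h : ∀ n ∈ Nspace C, m ≤ psi n → psi n ≤ M → K ≤ psi (ftil C n a) p) :
    K ≤ (Fenv C m M a).1 p := by
  refine le_csInf ((Set.nonempty_Icc.2 hmM).image _) ?_
  rintro _ ⟨x, hx, rfl⟩
  refine le_csInf ((exists_mem_Nspace (hx.2.trans hMC)).image _) ?_
  rintro _ ⟨n, ⟨hn, rfl⟩, rfl⟩
  exact h n hn hx.1 hx.2

theorem Fenv_snd_le_capacity {I : ℕ} (C m M : Fin I → ℕ) (a : Ev I) : (Fenv C m M a).2 ≤ C :=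
  fun p => Fenv_snd_le fun _ hn _ _ => psi_ftil_le hn a p

theorem Fenv_fst_le_snd {I : ℕ} {C m M : Fin I → ℕ} (hmM : m ≤ M) (hMC : M ≤ C) (a : Ev I) :
    (Fenv C m M a).1 ≤ (Fenv C m M a).2 := by
  intro p
  obtain ⟨n, hn⟩ := exists_mem_Nspace (hmM.trans hMC)
  have hm : m ∈ Set.Icc m M := ⟨le_rfl, hmM⟩
  have h1 : finf C m a p ≤ psi (ftil C n a) p := Nat.sInf_le ⟨n, hn, rfl⟩
  have h2 : psi (ftil C n a) p ≤ fbar C m a p := by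
    refine le_csSup ⟨C p, ?_⟩ ⟨n, hn, rfl⟩
    rintro _ ⟨n', hn', rfl⟩
    exact psi_ftil_le hn'.1 a p
  have h3 : (Fenv C m M a).1 p ≤ finf C m a p := Nat.sInf_le ⟨m, hm, rfl⟩
  have h4 : fbar C m a p ≤ (Fenv C m M a).2 p := by
    refine le_csSup ⟨C p, ?_⟩ ⟨m, hm, rfl⟩
    rintro _ ⟨x, -, rfl⟩
    refine csSup_le' ?_
    rintro _ ⟨n', hn', rfl⟩
    exact psi_ftil_le hn'.1 a p
  exact h3.trans (h1.trans (h2.trans h4))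

theorem Fenv_snd_d_le {I : ℕ} (C m M : Fin I → ℕ) (A : Finset (Fin I)) (p : Fin I) :
    (Fenv C m M (.d A)).2 p ≤ M p + if p ∈ A then 1 else 0 := by
  refine Fenv_snd_le fun n _ _ h => ?_
  have hp : psi n p ≤ M p := h p
  rw [psi_ftil_d]
  split_ifs with h1 h2 h2
  · omega
  · exact absurd h1.1 h2
  · omega
  · omega

theorem Fenv_snd_s_le {I : ℕ} (C m M : Fin I → ℕ) (i : Fin I) (j : ℕ) (p : Fin I) :
    (Fenv C m M (.s i j)).2 p ≤ M p :=
  Fenv_snd_le fun n _ _ h => (psi_ftil_s_le C n i j p).trans (h p)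

theorem Fenv_snd_s_self_add_one_le {I : ℕ} (C m M : Fin I → ℕ) {i : Fin I}
    {j : ℕ} (h0 : ∀ t < i, M t = 0) (hj1 : 1 ≤ j) (hj : j ≤ M i) :
    (Fenv C m M (.s i j)).2 i + 1 ≤ M i := by
  have : (Fenv C m M (.s i j)).2 i ≤ M i - 1 := by
    refine Fenv_snd_le fun n _ _ h => ?_
    have hi : psi n i ≤ M i := h i
    rcases hi.eq_or_lt with he | hlt
    · have := psi_ftil_s_self_add_one_le C n i (j := j)
        (fun t ht => Nat.le_zero.1 ((h t).trans (h0 t ht).le)) hj1 (hj.trans he.ge)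
      omega
    · have := psi_ftil_s_le C n i j i
      omega
  omega

theorem le_Fenv_fst_d {I : ℕ} {C m M : Fin I → ℕ} (hmM : m ≤ M) (hMC : M ≤ C)
    (A : Finset (Fin I)) (p : Fin I) (hp : m p < C p) :
    m p + (if p ∈ A then 1 else 0) ≤ (Fenv C m M (.d A)).1 p := by
  refine le_Fenv_fst hmM hMC fun n _ h _ => ?_
  have hpn : m p ≤ psi n p := h p
  rw [psi_ftil_d]
  split_ifs with h1 h2 h2
  · omega
  · have : ¬ psi n p < C p := fun h => h2 ⟨h1, h⟩
    omega
  · omega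
  · omega

theorem le_Fenv_fst_s {I : ℕ} {C m M : Fin I → ℕ} (hmM : m ≤ M) (hMC : M ≤ C)
    (i : Fin I) (j : ℕ) (p : Fin I) :
    m p ≤ (Fenv C m M (.s i j)).1 p + if i < p ∨ (i = p ∧ j ≤ m p) then 1 else 0 := by
  suffices m p - (if i < p ∨ (i = p ∧ j ≤ m p) then 1 else 0) ≤ (Fenv C m M (.s i j)).1 p by
    omega
  refine le_Fenv_fst hmM hMC fun n _ h _ => ?_
  have hp : m p ≤ psi n p := h p
  have h1 := psi_le_psi_ftil_s_add_one C n i j p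
  split_ifs with hc
  · omega
  · push Not at hc
    rcases hc.1.eq_or_lt with rfl | hlt
    · have hj := hc.2 rfl
      rcases hp.eq_or_lt with he | hlt
      · rw [psi_ftil_s_self_of_lt C n p (he ▸ hj)]
        exact (Nat.sub_le _ _).trans hp
      · omega
    · rw [psi_ftil_s_of_lt C n j hlt]
      exact (Nat.sub_le _ _).trans hp

theorem FenvIter_append {I : ℕ} (C m M : Fin I → ℕ) (w : List (Ev I)) (a : Ev I) :
    FenvIter C m M (w ++ [a]) = Fenv C (FenvIter C m M w).1 (FenvIter C m M w).2 a := by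
  induction w generalizing m M with
  | nil => rfl
  | cons b w ih => exact ih _ _

theorem FenvIter_bounds {I : ℕ} (C : Fin I → ℕ) (w : List (Ev I)) :
    (FenvIter C 0 C w).1 ≤ (FenvIter C 0 C w).2 ∧ (FenvIter C 0 C w).2 ≤ C := by
  induction w using List.reverseRecOn with
  | nil => exact ⟨fun _ => Nat.zero_le _, le_rfl⟩
  | append_singleton w a ih =>
    rw [FenvIter_append]
    exact ⟨Fenv_fst_le_snd ih.1 ih.2 a, Fenv_snd_le_capacity _ _ _ _⟩

theorem fword_succ {I : ℕ} (ω : ℕ → Ev I) (t : ℕ) :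
    fword ω (t + 1) = fword ω t ++ [ω (t + 1)] := by
  simp [fword, List.range_succ]

theorem fword_eq_iff {I : ℕ} (ω u : ℕ → Ev I) (t : ℕ) :
    fword ω t = fword u t ↔ ∀ s ∈ Finset.Icc 1 t, ω s = u s := by
  simp only [fword, List.map_inj_left, List.mem_range, Finset.mem_Icc]
  constructor
  · rintro h s ⟨h1, h2⟩
    simpa [Nat.sub_add_cancel h1] using h (s - 1) (by omega)
  · exact fun h s hs => h (s + 1) ⟨by omega, by omega⟩

instance inst_s15 (I : ℕ) : Countable (Ev I) := by
  let f : Ev I → Finset (Fin I) ⊕ (Fin I × ℕ) := fun a => match a with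
    | .d A => Sum.inl A
    | .s i j => Sum.inr (i, j)
  refine Function.Injective.countable (f := f) ?_
  rintro (A | ⟨i, j⟩) (B | ⟨k, l⟩) h <;> simp_all [f]

/-- No prefix of the word `w`, including `w` itself, is mapped to `0` by `V`. -/
def Alive {I : ℕ} (V : List (Ev I) → ℕ) (w : List (Ev I)) : Prop :=
  ∀ v, v <+: w → V v ≠ 0

theorem alive_append {I : ℕ} (V : List (Ev I) → ℕ) (w : List (Ev I)) (a : Ev I) :
    Alive V (w ++ [a]) ↔ Alive V w ∧ V (w ++ [a]) ≠ 0 := by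
  simp only [Alive, List.prefix_concat_iff]
  constructor
  · exact fun h => ⟨fun v hv => h v (Or.inr hv), h _ (Or.inl rfl)⟩
  · rintro ⟨h1, h2⟩ v (rfl | hv)
    · exact h2
    · exact h1 v hv

theorem exists_of_not_alive_fword {I : ℕ} (V : List (Ev I) → ℕ) (ω : ℕ → Ev I) (t : ℕ)
    (h : ¬ Alive V (fword ω t)) : ∃ s ≤ t, V (fword ω s) = 0 := by
  induction t with
  | zero =>
    refine ⟨0, le_rfl, ?_⟩
    by_contra h0
    refine h fun v hv => ?_
    rw [show fword ω 0 = [] from rfl] at hv h0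
    rwa [List.prefix_nil.1 hv]
  | succ t ih =>
    rw [fword_succ, alive_append, not_and_or] at h
    rcases h with h | h
    · obtain ⟨s, hs, h0⟩ := ih h
      exact ⟨s, by omega, h0⟩
    · exact ⟨t + 1, le_rfl, by rw [fword_succ]; exact not_not.1 h⟩

/-- The number of steps before `V` vanishes along the trajectory `ω`. -/
noncomputable def aliveTime {I : ℕ} (V : List (Ev I) → ℕ) (ω : ℕ → Ev I) : ℝ≥0∞ :=
  open Classical in ∑' t : ℕ, if Alive V (fword ω t) then 1 else 0

theorem exists_le_aliveTime {I : ℕ} (V : List (Ev I) → ℕ) (ω : ℕ → Ev I)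
    (h : aliveTime V ω ≠ ∞) : ∃ s : ℕ, (s : ℝ≥0∞) ≤ aliveTime V ω ∧ V (fword ω s) = 0 := by
  classical
  have hex : ∃ t, V (fword ω t) = 0 := by
    by_contra! hne
    have halive : ∀ t, Alive V (fword ω t) := fun t => by
      by_contra hc
      obtain ⟨s, -, hs⟩ := exists_of_not_alive_fword V ω t hc
      exact hne s hs
    refine h ?_
    simp [aliveTime, halive]
  refine ⟨Nat.find hex, ?_, Nat.find_spec hex⟩
  have halive : ∀ t < Nat.find hex, Alive V (fword ω t) := fun t ht => by
    by_contra hc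
    obtain ⟨s, hs, h0⟩ := exists_of_not_alive_fword V ω t hc
    exact Nat.find_min hex (hs.trans_lt ht) h0
  calc ((Nat.find hex : ℕ) : ℝ≥0∞)
      = ∑ t ∈ Finset.range (Nat.find hex), if Alive V (fword ω t) then 1 else 0 := by
        rw [Finset.sum_congr rfl fun t ht => if_pos (halive t (Finset.mem_range.1 ht))]
        simp
    _ ≤ _ := ENNReal.sum_le_tsum _

theorem measurableSet_fword_eq {I : ℕ} (t : ℕ) (w : List (Ev I)) :
    MeasurableSet {ω : ℕ → Ev I | fword ω t = w} := by
  by_cases h : ∃ u : ℕ → Ev I, fword u t = w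
  · obtain ⟨u, rfl⟩ := h
    simp only [fword_eq_iff, Set.ofPred_forall]
    exact MeasurableSet.iInter fun s => MeasurableSet.iInter fun _ => by
      have h : MeasurableSet ({u s} : Set (Ev I)) := MeasurableSpace.measurableSet_top
      have hs : Measurable fun ω : ℕ → Ev I => ω s := measurable_pi_apply s
      exact hs h
  · push Not at h
    simp [h]

theorem measurable_comp_fword {I : ℕ} (t : ℕ) (g : List (Ev I) → ℝ≥0∞) :
    Measurable fun ω : ℕ → Ev I => g (fword ω t) := by
  let _ : MeasurableSpace (List (Ev I)) := ⊤
  have h1 : Measurable g := measurable_from_top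
  exact h1.comp (measurable_to_countable' fun w => measurableSet_fword_eq t w)

/-- Integrating one i.i.d. step: conditionally on the first `t` letters, the next letter has
law `q`. -/
theorem lintegral_fword_succ {I : ℕ} (P : Measure (ℕ → Ev I)) (q : Ev I → ℝ≥0∞)
    (hiid : ∀ (T : Finset ℕ) (u : ℕ → Ev I), P {ω | ∀ t ∈ T, ω t = u t} = ∏ t ∈ T, q (u t))
    (t : ℕ) (g : List (Ev I) → ℝ≥0∞) :
    ∫⁻ ω, g (fword ω (t + 1)) ∂P = ∫⁻ ω, ∑' a, q a * g (fword ω t ++ [a]) ∂P := by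
  let _ : MeasurableSpace (List (Ev I)) := ⊤
  have hmeas : ∀ s, Measurable fun ω : ℕ → Ev I => fword ω s :=
    fun s => measurable_to_countable' fun w => measurableSet_fword_eq s w
  have hlaw : ∀ w a, P {ω | fword ω t = w ∧ ω (t + 1) = a} = P {ω | fword ω t = w} * q a := by
    intro w a
    by_cases h : ∃ u : ℕ → Ev I, fword u t = w
    · obtain ⟨u, rfl⟩ := h
      have hu : ∀ s ∈ Finset.Icc 1 t, Function.update u (t + 1) a s = u s := by
        intro s hs
        rw [Finset.mem_Icc] at hs
        exact Function.update_of_ne (by omega) _ _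
      have h1 : {ω : ℕ → Ev I | fword ω t = fword u t ∧ ω (t + 1) = a} =
          {ω | ∀ s ∈ Finset.Icc 1 (t + 1), ω s = Function.update u (t + 1) a s} := by
        ext ω
        simp only [fword_eq_iff, Set.mem_ofPred_eq]
        rw [← Finset.insert_Icc_right_eq_Icc_add_one (by omega), Finset.forall_mem_insert,
          Function.update_self, and_comm]
        refine and_congr_right fun _ => forall₂_congr fun s hs => ?_
        rw [hu s hs]
      rw [h1]
      simp only [fword_eq_iff]
      rw [hiid, hiid, Finset.prod_Icc_succ_top (by omega), Function.update_self]
      congr 1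
      exact Finset.prod_congr rfl fun s hs => by rw [hu s hs]
    · push Not at h
      simp [h]
  have hpair : Measurable fun ω : ℕ → Ev I => (fword ω t, ω (t + 1)) :=
    (hmeas t).prodMk (measurable_pi_apply _)
  calc ∫⁻ ω, g (fword ω (t + 1)) ∂P
      = ∫⁻ x, g (x.1 ++ [x.2]) ∂(P.map fun ω => (fword ω t, ω (t + 1))) := by
        rw [lintegral_map (measurable_of_countable _) hpair]
        simp only [fword_succ]
    _ = ∑' w, ∑' a, g (w ++ [a]) * (P {ω | fword ω t = w} * q a) := by
        rw [lintegral_countable', ENNReal.tsum_prod']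
        refine tsum_congr fun w => tsum_congr fun a => ?_
        rw [Measure.map_apply hpair (measurableSet_singleton _), ← hlaw]
        congr 2
        ext ω
        simp
    _ = ∑' w, (∑' a, q a * g (w ++ [a])) * P {ω | fword ω t = w} := by
        refine tsum_congr fun w => ?_
        rw [← ENNReal.tsum_mul_right]
        exact tsum_congr fun a => by ring
    _ = ∫⁻ w, ∑' a, q a * g (w ++ [a]) ∂(P.map fun ω => fword ω t) := by
        rw [lintegral_countable']
        refine tsum_congr fun w => ?_
        rw [Measure.map_apply (hmeas t) (measurableSet_singleton _)]
        rfl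
    _ = _ := lintegral_map (measurable_of_countable _) (hmeas t)

/-- A Foster-Lyapunov bound for the time before `V` vanishes. -/
theorem mul_lintegral_aliveTime_le {I : ℕ} (P : Measure (ℕ → Ev I)) [IsProbabilityMeasure P]
    (q : Ev I → ℝ≥0∞)
    (hiid : ∀ (T : Finset ℕ) (u : ℕ → Ev I), P {ω | ∀ t ∈ T, ω t = u t} = ∏ t ∈ T, q (u t))
    (V : List (Ev I) → ℕ) (c : ℝ≥0∞)
    (hV : ∀ w, V w ≠ 0 → ∑' a, q a * (V (w ++ [a]) : ℝ≥0∞) + c ≤ V w) :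
    c * ∫⁻ ω, aliveTime V ω ∂P ≤ V [] := by
  classical
  set D : List (Ev I) → ℝ≥0∞ := fun w => if Alive V w then 1 else 0 with hD
  set G : List (Ev I) → ℝ≥0∞ := fun w => V w * D w with hG
  have hstep : ∀ w, ∑' a, q a * G (w ++ [a]) + c * D w ≤ G w := by
    intro w
    by_cases hw : Alive V w
    · have h1 : ∀ a, q a * G (w ++ [a]) ≤ q a * (V (w ++ [a]) : ℝ≥0∞) := by
        intro a
        simp only [hG, hD]
        gcongr
        split_ifs <;> simp
      calc ∑' a, q a * G (w ++ [a]) + c * D w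
          ≤ ∑' a, q a * (V (w ++ [a]) : ℝ≥0∞) + c := by
            refine add_le_add (ENNReal.tsum_le_tsum h1) ?_
            simp [hD, hw]
        _ ≤ V w := hV w (hw w (List.prefix_refl w))
        _ = G w := by simp [hG, hD, hw]
    · simp [hG, hD, alive_append, hw]
  have hsum : ∀ N : ℕ, ∫⁻ ω, G (fword ω N) ∂P
      + c * ∑ t ∈ Finset.range N, ∫⁻ ω, D (fword ω t) ∂P ≤ V [] := by
    intro N
    induction N with
    | zero =>
      simp only [fword, List.range_zero, List.map_nil, lintegral_const, measure_univ, mul_one,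
        Finset.range_zero, Finset.sum_empty, mul_zero, add_zero, hG, hD]
      split_ifs <;> simp
    | succ N ih =>
      refine le_trans ?_ ih
      rw [Finset.sum_range_succ, mul_add, add_comm (c * _), ← add_assoc]
      refine add_le_add ?_ le_rfl
      rw [lintegral_fword_succ P q hiid, ← lintegral_const_mul _ (measurable_comp_fword N D),
        ← lintegral_add_right _ ((measurable_comp_fword N D).const_mul c)]
      exact lintegral_mono fun ω => hstep _
  have htime : ∫⁻ ω, aliveTime V ω ∂P = ∑' t, ∫⁻ ω, D (fword ω t) ∂P :=
    lintegral_tsum fun t => (measurable_comp_fword t D).aemeasurable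
  rw [htime, ← ENNReal.tsum_mul_left]
  refine ENNReal.tsum_le_of_sum_range_le fun N => ?_
  rw [← Finset.mul_sum]
  exact le_add_self.trans (hsum N)

theorem tsum_probJ_mul {I : ℕ} (C : Fin I → ℕ) (lam : Finset (Fin I) → ℝ) (μv Λ : ℝ)
    (hlam : ∀ A, 0 ≤ lam A) (hlam0 : lam ∅ = 0) (hμ : 0 < μv) (hΛ : 0 < Λ) (g : Ev I → ℕ) :
    ∑' a, probJ C lam μv Λ a * (g a : ℝ≥0∞) =
      ENNReal.ofReal ((∑ A, lam A * (g (.d A) : ℝ)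
        + μv * ∑ i, ∑ j ∈ Finset.Icc 1 (C i), (g (.s i j) : ℝ)) / Λ) := by
  let e : Finset (Fin I) ⊕ (Fin I × ℕ) ≃ Ev I :=
    { toFun := fun x => match x with
        | Sum.inl A => .d A
        | Sum.inr (i, j) => .s i j
      invFun := fun a => match a with
        | .d A => Sum.inl A
        | .s i j => Sum.inr (i, j)
      left_inv := by rintro (A | ⟨i, j⟩) <;> rfl
      right_inv := by rintro (A | ⟨i, j⟩) <;> rfl }
  rw [← e.tsum_eq, ENNReal.summable.tsum_sum ENNReal.summable, tsum_fintype,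
    ENNReal.tsum_prod', tsum_fintype, add_div, ENNReal.ofReal_add, Finset.sum_div,
    ENNReal.ofReal_sum_of_nonneg]
  · congr 1
    · refine Finset.sum_congr rfl fun A _ => ?_
      change (if A.Nonempty then ENNReal.ofReal (lam A / Λ) else 0) * _ = _
      split_ifs with hA
      · rw [← ENNReal.ofReal_natCast, ← ENNReal.ofReal_mul (div_nonneg (hlam A) hΛ.le)]
        congr 1
        change lam A / Λ * (g (.d A) : ℝ) = _
        ring
      · rw [Finset.not_nonempty_iff_eq_empty] at hA
        simp [hA, hlam0]
    · rw [mul_div_right_comm, Finset.mul_sum, ENNReal.ofReal_sum_of_nonneg fun i _ => by positivity]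
      refine Finset.sum_congr rfl fun i _ => ?_
      rw [Finset.mul_sum, ENNReal.ofReal_sum_of_nonneg fun i _ => by positivity,
        tsum_eq_sum (s := Finset.Icc 1 (C i))]
      · refine Finset.sum_congr rfl fun j hj => ?_
        change (if 1 ≤ j ∧ j ≤ C i then ENNReal.ofReal (μv / Λ) else 0) * (g (.s i j) : ℝ≥0∞) = _
        rw [if_pos (Finset.mem_Icc.1 hj), ← ENNReal.ofReal_natCast,
          ← ENNReal.ofReal_mul (by positivity)]
      · intro j hj
        change (if 1 ≤ j ∧ j ≤ C i then ENNReal.ofReal (μv / Λ) else 0) * (g (.s i j) : ℝ≥0∞) = _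
        rw [if_neg (fun h => hj (Finset.mem_Icc.2 h)), zero_mul]
  · exact fun A _ => div_nonneg (mul_nonneg (hlam A) (Nat.cast_nonneg _)) hΛ.le
  · exact div_nonneg (Finset.sum_nonneg fun A _ => mul_nonneg (hlam A) (Nat.cast_nonneg _)) hΛ.le
  · positivity

/-- The expected number of steps before `V` vanishes, when the mean increments of `V` in
continuous time are at most `-c`. -/
theorem lintegral_aliveTime_le {I : ℕ} (C : Fin I → ℕ) (lam : Finset (Fin I) → ℝ) (μv Λ : ℝ)
    (hlam : ∀ A, 0 ≤ lam A) (hlam0 : lam ∅ = 0) (hμ : 0 < μv) (hΛpos : 0 < Λ)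
    (hΛ : Λ = (∑ A : Finset (Fin I), lam A) + μv * ∑ i, (C i : ℝ))
    (P : Measure (ℕ → Ev I)) [IsProbabilityMeasure P]
    (hiid : ∀ (T : Finset ℕ) (u : ℕ → Ev I),
        P {ω | ∀ t ∈ T, ω t = u t} = ∏ t ∈ T, probJ C lam μv Λ (u t))
    (V : List (Ev I) → ℕ) (c : ℝ) (hc : 0 < c)
    (e : List (Ev I) → Ev I → ℝ) (he : ∀ w a, V w ≠ 0 → (V (w ++ [a]) : ℝ) ≤ V w + e w a)
    (hdrift : ∀ w, V w ≠ 0 → ∑ A, lam A * e w (.d A)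
        + μv * ∑ i, ∑ j ∈ Finset.Icc 1 (C i), e w (.s i j) ≤ -c) :
    ∫⁻ ω, aliveTime V ω ∂P ≤ ENNReal.ofReal (Λ * V [] / c) := by
  have key := mul_lintegral_aliveTime_le P _ hiid V (ENNReal.ofReal (c / Λ)) fun w hw => by
    rw [tsum_probJ_mul C lam μv Λ hlam hlam0 hμ hΛpos (fun a => V (w ++ [a])),
      ← ENNReal.ofReal_add _ (by positivity), ← ENNReal.ofReal_natCast]
    · refine ENNReal.ofReal_le_ofReal ?_
      rw [← add_div, div_le_iff₀ hΛpos]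
      have h1 : ∑ A, lam A * (V (w ++ [.d A]) : ℝ) ≤ ∑ A, lam A * (V w + e w (.d A)) :=
        Finset.sum_le_sum fun A _ => mul_le_mul_of_nonneg_left (he w _ hw) (hlam A)
      have h2 : μv * ∑ i, ∑ j ∈ Finset.Icc 1 (C i), (V (w ++ [.s i j]) : ℝ) ≤
          μv * ∑ i, ∑ j ∈ Finset.Icc 1 (C i), ((V w : ℝ) + e w (.s i j)) :=
        mul_le_mul_of_nonneg_left (Finset.sum_le_sum fun i _ => Finset.sum_le_sum fun j _ =>
          he w _ hw) hμ.le
      simp only [mul_add, Finset.sum_add_distrib, ← Finset.sum_mul, Finset.sum_const,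
        Nat.card_Icc, nsmul_eq_mul, Nat.add_sub_cancel] at h1 h2
      have h3 := hdrift w hw
      rw [hΛ]
      linarith
    · have h1 : 0 ≤ ∑ A, lam A * (V (w ++ [.d A]) : ℝ) :=
        Finset.sum_nonneg fun A _ => mul_nonneg (hlam A) (Nat.cast_nonneg _)
      positivity
  have hcpos : 0 < c / Λ := by positivity
  rw [show Λ * (V [] : ℝ) / c = (V [] : ℝ) / (c / Λ) by field_simp,
    ENNReal.ofReal_div_of_pos hcpos, ENNReal.ofReal_natCast,
    ENNReal.le_div_iff_mul_le (Or.inl (by simpa using hcpos)) (Or.inl ENNReal.ofReal_ne_top),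
    mul_comm]
  exact key

/-- Theorem 5: bound on the stopping time of the modified aggregated-envelope algorithm. -/
theorem stmt15 (I : ℕ) (hI : 1 ≤ I) (C : Fin I → ℕ) (hC : ∀ i, 1 ≤ C i)
    (lam : Finset (Fin I) → ℝ) (hlamnn : ∀ A, 0 ≤ lam A) (hlam0 : lam ∅ = 0)
    (μv : ℝ) (hμv : 0 < μv)
    (Λ : ℝ) (hΛ : Λ = (∑ A : Finset (Fin I), lam A) + μv * ∑ i, (C i : ℝ))
    (lamI : Fin I → ℝ)
    (hlamI : ∀ i, lamI i = ∑ A ∈ Finset.univ.filter (fun A => i ∈ A), lam A)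
    (P : Measure (ℕ → Ev I)) [IsProbabilityMeasure P]
    (hiid : ∀ (T : Finset ℕ) (u : ℕ → Ev I),
        P {ω | ∀ t ∈ T, ω t = u t} = ∏ t ∈ T, probJ C lam μv Λ (u t))
    (I0 IC : Finset (Fin I)) (hcover : I0 ∪ IC = Finset.univ)
    (hi : ∑ i ∈ I0, lamI i < μv)
    (δ : Fin I → ℝ)
    (hδ : ∀ p, δ p = lamI p - μv * ((∑ t ∈ Finset.univ.filter (fun t => t ≤ p), (C t : ℝ)) - 1))
    (hii : ∀ p ∈ IC, 0 < δ p)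
    (hiii : ∀ i ∈ I0, ∀ j ∈ IC, i ≤ j) :
    ∫⁻ ω, sInf {r : ℝ≥0∞ | ∃ t : ℕ, r = t ∧ ∀ p : Fin I, ∃ s ≤ t,
        (FenvIter C 0 C (fword ω s)).1 p = (FenvIter C 0 C (fword ω s)).2 p} ∂P
      ≤ ENNReal.ofReal (Λ / (μv - ∑ i ∈ I0, lamI i) * ∑ i ∈ I0, (C i : ℝ)
          + ∑ p ∈ IC, Λ * (C p : ℝ) / δ p) := by
  classical
  have hΛpos : 0 < Λ := by
    have h1 : 0 ≤ ∑ A, lam A := Finset.sum_nonneg fun A _ => hlamnn A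
    have h2 : (0 : ℝ) < ∑ i, (C i : ℝ) := by
      refine Finset.sum_pos (fun i _ => by exact_mod_cast hC i) ⟨⟨0, hI⟩, Finset.mem_univ _⟩
    rw [hΛ]
    positivity
  set V0 : List (Ev I) → ℕ := fun w => ∑ i ∈ I0, (FenvIter C 0 C w).2 i with hV0
  set V : Fin I → List (Ev I) → ℕ := fun p w => C p - (FenvIter C 0 C w).1 p with hVdef
  have hlower : ∀ i ∈ I0, ∀ t < i, t ∈ I0 := by
    intro i hi0 t ht
    have := Finset.mem_univ t
    rw [← hcover, Finset.mem_union] at this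
    exact this.resolve_right fun h => absurd (hiii i hi0 t h) (not_le.2 ht)
  have hbound0 : ∫⁻ ω, aliveTime V0 ω ∂P
      ≤ ENNReal.ofReal (Λ * V0 [] / (μv - ∑ i ∈ I0, lamI i)) := by
    have hfirst : ∀ w, V0 w ≠ 0 → ∃ i ∈ I0, 1 ≤ (FenvIter C 0 C w).2 i ∧
        ∀ t < i, (FenvIter C 0 C w).2 t = 0 := by
      intro w hw
      set S := I0.filter fun i => (FenvIter C 0 C w).2 i ≠ 0 with hS
      have hSne : S.Nonempty := by
        by_contra hne
        refine hw (Finset.sum_eq_zero fun i hi0 => ?_)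
        by_contra h
        exact hne ⟨i, by simp [hS, hi0, h]⟩
      have hmin := Finset.min'_mem S hSne
      obtain ⟨hmin1, hmin2⟩ := Finset.mem_filter.1 hmin
      refine ⟨S.min' hSne, hmin1, Nat.one_le_iff_ne_zero.2 hmin2, fun t ht => ?_⟩
      by_contra h
      have : t ∈ S := by simp [hS, hlower _ hmin1 t ht, h]
      exact absurd (S.min'_le t this) (not_le.2 ht)
    have : Nonempty (Fin I) := ⟨⟨0, hI⟩⟩
    choose! f hfI hf1 hf0 using hfirst
    refine lintegral_aliveTime_le C lam μv Λ hlamnn hlam0 hμv hΛpos hΛ P hiid V0 _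
      (sub_pos.2 hi)
      (fun w a => match a with
        | .d A => ∑ i ∈ I0, if i ∈ A then 1 else 0
        | .s i j => if i = f w then (if j = 1 then -1 else 0) else 0) ?_ ?_
    · rintro w (A | ⟨i, j⟩) hw
      · simp only [hV0, FenvIter_append]
        have := Finset.sum_le_sum fun i (_ : i ∈ I0) =>
          Fenv_snd_d_le C (FenvIter C 0 C w).1 (FenvIter C 0 C w).2 A i
        rw [Finset.sum_add_distrib] at this
        exact_mod_cast this
      · have hle : ∀ t ∈ I0, (Fenv C (FenvIter C 0 C w).1 (FenvIter C 0 C w).2 (.s i j)).2 t ≤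
            (FenvIter C 0 C w).2 t := fun t _ => Fenv_snd_s_le C _ _ i j t
        simp only [hV0, FenvIter_append]
        split_ifs with h1 h2
        · subst h1 h2
          have := Finset.sum_lt_sum hle ⟨f w, hfI w hw,
            Fenv_snd_s_self_add_one_le C _ _ (hf0 w hw) le_rfl (hf1 w hw)⟩
          have h3 := Nat.succ_le_of_lt this
          have h4 : ((∑ t ∈ I0, (Fenv C (FenvIter C 0 C w).1 (FenvIter C 0 C w).2
            (.s (f w) 1)).2 t : ℕ) : ℝ) + 1 ≤ (∑ t ∈ I0, (FenvIter C 0 C w).2 t : ℕ) := by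
            exact_mod_cast h3
          linarith
        · rw [add_zero]
          exact_mod_cast Finset.sum_le_sum hle
        · rw [add_zero]
          exact_mod_cast Finset.sum_le_sum hle
    · intro w hw
      have h1 : ∑ A, lam A * (∑ i ∈ I0, if i ∈ A then (1 : ℝ) else 0) = ∑ i ∈ I0, lamI i := by
        simp only [hlamI, Finset.mul_sum, mul_ite, mul_one, mul_zero, Finset.sum_filter]
        exact Finset.sum_comm
      have h2 : ∑ i, ∑ j ∈ Finset.Icc 1 (C i),
          (if i = f w then (if j = 1 then (-1 : ℝ) else 0) else 0) = -1 := by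
        rw [Finset.sum_eq_single (f w)]
        · simp [hC]
        · intro b _ hb
          simp [hb]
        · simp
      simp only [h1, h2]
      linarith
  have hboundp : ∀ p ∈ IC, ∫⁻ ω, aliveTime (V p) ω ∂P
      ≤ ENNReal.ofReal (Λ * V p [] / δ p) := by
    intro p hp
    refine lintegral_aliveTime_le C lam μv Λ hlamnn hlam0 hμv hΛpos hΛ P hiid (V p) _ (hii p hp)
      (fun _ a => match a with
        | .d A => if p ∈ A then -1 else 0
        | .s i j => (if i ≤ p then 1 else 0) - if i = p then (if j = C p then 1 else 0) else 0)
      ?_ ?_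
    · intro w a hw
      obtain ⟨hmM, hMC⟩ := FenvIter_bounds C w
      have hlt : (FenvIter C 0 C w).1 p < C p := Nat.lt_of_sub_ne_zero hw
      have hC' : (Fenv C (FenvIter C 0 C w).1 (FenvIter C 0 C w).2 a).1 p ≤ C p :=
        (Fenv_fst_le_snd hmM hMC a p).trans (Fenv_snd_le_capacity _ _ _ _ p)
      simp only [hVdef, FenvIter_append]
      rw [Nat.cast_sub hC', Nat.cast_sub hlt.le]
      obtain A | ⟨i, j⟩ := a
      · have h := le_Fenv_fst_d hmM hMC A p hlt
        simp only
        split_ifs at h ⊢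
        · have h' : ((FenvIter C 0 C w).1 p : ℝ) + 1 ≤
            (Fenv C (FenvIter C 0 C w).1 (FenvIter C 0 C w).2 (.d A)).1 p := by exact_mod_cast h
          linarith
        · have h' : ((FenvIter C 0 C w).1 p : ℝ) ≤
            (Fenv C (FenvIter C 0 C w).1 (FenvIter C 0 C w).2 (.d A)).1 p := by exact_mod_cast h
          linarith
      · have h := le_Fenv_fst_s hmM hMC i j p
        have h' : ((FenvIter C 0 C w).1 p : ℝ) ≤
            (Fenv C (FenvIter C 0 C w).1 (FenvIter C 0 C w).2 (.s i j)).1 p +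
              if i < p ∨ (i = p ∧ j ≤ (FenvIter C 0 C w).1 p) then 1 else 0 := by
          exact_mod_cast h
        have h3 : (if i < p ∨ (i = p ∧ j ≤ (FenvIter C 0 C w).1 p) then (1 : ℝ) else 0) ≤
            (if i ≤ p then 1 else 0) - if i = p then (if j = C p then 1 else 0) else 0 := by
          rcases lt_trichotomy i p with h | h | h
          · simp [h, h.le, h.ne]
          · subst h
            by_cases hj : j = C i
            · simp [hj, not_le.2 hlt]
            · simp only [hj, lt_irrefl, true_and, false_or, le_refl, if_true, if_false, sub_zero]
              split_ifs <;> norm_num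
          · simp [h.ne', not_lt.2 h.le, not_le.2 h]
        linarith
    · intro w _
      have h1 : ∑ A, lam A * (if p ∈ A then (-1 : ℝ) else 0) = -lamI p := by
        rw [hlamI, Finset.sum_filter, ← Finset.sum_neg_distrib]
        refine Finset.sum_congr rfl fun A _ => ?_
        split_ifs <;> simp
      have h2 : ∑ i, ∑ j ∈ Finset.Icc 1 (C i), ((if i ≤ p then (1 : ℝ) else 0) -
          if i = p then (if j = C p then 1 else 0) else 0) =
          (∑ t ∈ Finset.univ.filter (fun t => t ≤ p), (C t : ℝ)) - 1 := by
        simp only [Finset.sum_sub_distrib]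
        congr 1
        · rw [Finset.sum_filter]
          refine Finset.sum_congr rfl fun i _ => ?_
          split_ifs <;> simp
        · rw [Finset.sum_eq_single p]
          · simp [hC]
          · intro b _ hb
            simp [hb]
          · simp
      simp only [h1, h2, hδ]
      linarith
  have hmeas : ∀ W : List (Ev I) → ℕ, Measurable (aliveTime W) := fun W =>
    Measurable.tsum fun t => measurable_comp_fword t fun w => if Alive W w then 1 else 0
  have hpoint : ∀ ω, sInf {r : ℝ≥0∞ | ∃ t : ℕ, r = t ∧ ∀ p : Fin I, ∃ s ≤ t,
        (FenvIter C 0 C (fword ω s)).1 p = (FenvIter C 0 C (fword ω s)).2 p} ≤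
      aliveTime V0 ω + ∑ p ∈ IC, aliveTime (V p) ω := by
    intro ω
    by_cases htop : aliveTime V0 ω + ∑ p ∈ IC, aliveTime (V p) ω = ∞
    · rw [htop]
      exact le_top
    have h0 : aliveTime V0 ω ≠ ∞ := fun h => htop (by simp [h])
    have hp : ∀ p ∈ IC, aliveTime (V p) ω ≠ ∞ := by
      have := (ENNReal.add_ne_top.1 htop).2
      rw [ENNReal.sum_ne_top] at this
      exact this
    obtain ⟨s0, hs0, hz0⟩ := exists_le_aliveTime V0 ω h0
    choose! s hs hz using fun p hpc => exists_le_aliveTime (V p) ω (hp p hpc)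
    refine le_trans (sInf_le (a := ((s0 + ∑ p ∈ IC, s p : ℕ) : ℝ≥0∞)) ?_) ?_
    · refine ⟨_, rfl, fun p => ?_⟩
      have := Finset.mem_univ p
      rw [← hcover, Finset.mem_union] at this
      rcases this with hp0 | hpc
      · refine ⟨s0, by omega, ?_⟩
        have hM := Finset.sum_eq_zero_iff.1 hz0 p hp0
        have hm : (FenvIter C 0 C (fword ω s0)).1 p ≤ (FenvIter C 0 C (fword ω s0)).2 p :=
          (FenvIter_bounds C _).1 p
        omega
      · refine ⟨s p, (Finset.single_le_sum (fun _ _ => Nat.zero_le _) hpc).trans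
          (Nat.le_add_left _ _), ?_⟩
        have h1 : (FenvIter C 0 C (fword ω (s p))).1 p ≤ (FenvIter C 0 C (fword ω (s p))).2 p :=
          (FenvIter_bounds C _).1 p
        have h2 : (FenvIter C 0 C (fword ω (s p))).2 p ≤ C p := (FenvIter_bounds C _).2 p
        have h3 := hz p hpc
        simp only [hVdef] at h3
        omega
    · push_cast
      exact add_le_add hs0 (Finset.sum_le_sum fun p hpc => hs p hpc)
  refine (lintegral_mono hpoint).trans ?_
  have hμI : 0 < μv - ∑ i ∈ I0, lamI i := sub_pos.2 hi
  have hnonneg : ∀ p ∈ IC, 0 ≤ Λ * (C p : ℝ) / δ p := fun p hp => by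
    have := hii p hp
    positivity
  rw [lintegral_add_left (hmeas V0), lintegral_finsetSum _ fun p _ => hmeas (V p),
    ENNReal.ofReal_add (by positivity) (Finset.sum_nonneg hnonneg),
    ENNReal.ofReal_sum_of_nonneg hnonneg]
  refine add_le_add (hbound0.trans (le_of_eq ?_))
    (Finset.sum_le_sum fun p hp => (hboundp p hp).trans (le_of_eq ?_))
  · congr 1
    simp only [hV0, FenvIter]
    push_cast
    ring
  · simp [hVdef, FenvIter]

end ATO
end
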